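/- Let α < 0 and let y be a minimal solution of the second Painlevé equation y''(s) = s·y(s) + 2·y(s)³ + α which is bounded on a neighborhood of +∞ and vanishes at some point s̄ ∈ ℝ. Then s̄ is the unique zero of y, y(s) > 0 for all s > s̄, y(s) < 0 for all s < s̄, s·y(s) → |α| as s → +∞, and y(s) + √(|s|/2) → 0 as s → −∞. -/

import Mathlib

open MeasureTheory Filter Topology Set


/-- The Painlevé II energy of `u` over a set `I`. -/
noncomputable def EPII (α : ℝ) (u : ℝ → ℝ) (I : Set ℝ) : ℝ :=
  ∫ s in I, ((1:ℝ)/2 * (deriv u s) ^ 2 + 1/2 * s * (u s) ^ 2 + 1/2 * (u s) ^ 4 + α * u s)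

/-- A (classical) solution of the second Painlevé equation `y'' = s y + 2 y³ + α`. -/
def PainleveSol (α : ℝ) (y : ℝ → ℝ) : Prop :=
  ContDiff ℝ 2 y ∧ ∀ s : ℝ, deriv (deriv y) s = s * y s + 2 * (y s) ^ 3 + α

/-- A minimal solution of the second Painlevé equation: it minimizes `E_PII` with respect to
smooth compactly supported perturbations. -/
def MinimalSol (α : ℝ) (y : ℝ → ℝ) : Prop :=
  PainleveSol α y ∧ ∀ φ : ℝ → ℝ, ContDiff ℝ (⊤ : ℕ∞) φ → HasCompactSupport φ →
    EPII α y (tsupport φ) ≤ EPII α (fun s => y s + φ s) (tsupport φ)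

/-- A nonnegative derivative on `[a, b]` gives an increase from `a` to `b`. -/
lemma le_of_hasDerivAt_nonneg {f f' : ℝ → ℝ} {a b : ℝ} (hab : a ≤ b)
    (hf : ∀ x ∈ Icc a b, HasDerivAt f (f' x) x) (hf' : ∀ x ∈ Ioo a b, 0 ≤ f' x) :
    f a ≤ f b := by
  have hmono : MonotoneOn f (Icc a b) := by
    apply monotoneOn_of_deriv_nonneg (convex_Icc a b)
    · exact fun x hx => (hf x hx).continuousAt.continuousWithinAt
    · intro x hx
      rw [interior_Icc] at hx
      exact (hf x (Ioo_subset_Icc_self hx)).differentiableAt.differentiableWithinAt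
    · intro x hx
      rw [interior_Icc] at hx
      rw [(hf x (Ioo_subset_Icc_self hx)).deriv]
      exact hf' x hx
  exact hmono (left_mem_Icc.2 hab) (right_mem_Icc.2 hab) hab

/-- A function that is uniformly convex where it is positive grows quadratically after any
point at which it is positive and nondecreasing. -/
lemma quadratic_growth {f f' f'' : ℝ → ℝ} {X c : ℝ} (hc : 0 < c)
    (h1 : ∀ x, X ≤ x → HasDerivAt f (f' x) x) (h2 : ∀ x, X ≤ x → HasDerivAt f' (f'' x) x)
    (h3 : ∀ x, X ≤ x → 0 < f x → c ≤ f'' x) {x₀ : ℝ} (hx₀ : X ≤ x₀) (hf : 0 < f x₀)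
    (hf' : 0 ≤ f' x₀) {x : ℝ} (hx : x₀ ≤ x) :
    f x₀ + c / 2 * (x - x₀) ^ 2 ≤ f x ∧ c * (x - x₀) ≤ f' x := by
  have key : ∀ z, x₀ ≤ z → (∀ t ∈ Ioo x₀ z, 0 < f t) →
      f x₀ + c / 2 * (z - x₀) ^ 2 ≤ f z ∧ c * (z - x₀) ≤ f' z := by
    intro z hz hpos
    have hd : ∀ t ∈ Icc x₀ z, c * (t - x₀) ≤ f' t := by
      intro t ht
      have := le_of_hasDerivAt_nonneg (f := fun r => f' r - c * (r - x₀))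
        (f' := fun r => f'' r - c * 1) ht.1
        (fun r hr => (h2 r (hx₀.trans hr.1)).sub
          (((hasDerivAt_id r).sub_const x₀).const_mul c))
        (fun r hr => by
          have := h3 r (hx₀.trans hr.1.le) (hpos r ⟨hr.1, hr.2.trans_le ht.2⟩)
          linarith)
      simp only [sub_self, mul_zero, sub_zero] at this
      linarith
    refine ⟨?_, hd z ⟨hz, le_rfl⟩⟩
    have := le_of_hasDerivAt_nonneg (f := fun r => f r - c / 2 * (r - x₀) ^ 2)
      (f' := fun r => f' r - c / 2 * (((2 : ℕ) : ℝ) * (r - x₀) ^ (2 - 1) * 1)) hz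
      (fun r hr => (h1 r (hx₀.trans hr.1)).sub
        ((((hasDerivAt_id r).sub_const x₀).pow 2).const_mul (c / 2)))
      (fun r hr => by
        have := hd r ⟨hr.1.le, hr.2.le⟩
        norm_num
        linarith)
    simp only [sub_self] at this
    norm_num at this
    linarith
  refine key x hx fun t ht => ?_
  by_contra! hneg
  have hcont : ContinuousOn f (Icc x₀ t) := fun r hr =>
    (h1 r (hx₀.trans hr.1)).continuousAt.continuousWithinAt
  have hcl : IsClosed (Icc x₀ t ∩ f ⁻¹' Iic 0) :=
    hcont.preimage_isClosed_of_isClosed isClosed_Icc isClosed_Iic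
  have hcomp : IsCompact (Icc x₀ t ∩ f ⁻¹' Iic 0) :=
    isCompact_Icc.of_isClosed_subset hcl inter_subset_left
  obtain ⟨z, ⟨hzm, hz0⟩, hzl⟩ := hcomp.exists_isLeast ⟨t, ⟨ht.1.le, le_rfl⟩, hneg⟩
  have := (key z hzm.1 (fun r hr => by
    by_contra! hr0
    exact absurd (hzl ⟨⟨hr.1.le, hr.2.le.trans hzm.2⟩, hr0⟩) (not_le.2 hr.2))).1
  have hz0' : f z ≤ 0 := hz0
  have : 0 ≤ c / 2 * (z - x₀) ^ 2 := by positivity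
  linarith

/-- If a function is uniformly convex and decreasing wherever it is positive, then it is
eventually nonpositive. -/
lemma eventually_nonpos_of_neg_deriv {f f' f'' : ℝ → ℝ} {X c : ℝ} (hc : 0 < c)
    (h1 : ∀ x, X ≤ x → HasDerivAt f (f' x) x) (h2 : ∀ x, X ≤ x → HasDerivAt f' (f'' x) x)
    (h3 : ∀ x, X ≤ x → 0 < f x → c ≤ f'' x) (h4 : ∀ x, X ≤ x → 0 < f x → f' x < 0) :
    ∀ᶠ x in atTop, f x ≤ 0 := by
  have hex : ∃ x₁, X ≤ x₁ ∧ f x₁ ≤ 0 := by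
    by_contra! hpos
    have hX : f' X < 0 := h4 X le_rfl (hpos X le_rfl)
    set z := X + -f' X / c with hz
    have hXz : X ≤ z := by
      have : 0 < -f' X / c := div_pos (by linarith) hc
      linarith
    have := le_of_hasDerivAt_nonneg (f := fun r => f' r - c * (r - X))
      (f' := fun r => f'' r - c * 1) hXz
      (fun r hr => (h2 r hr.1).sub (((hasDerivAt_id r).sub_const X).const_mul c))
      (fun r hr => by
        have := h3 r hr.1.le (hpos r hr.1.le)
        linarith)
    have hcz : c * (z - X) = -f' X := by
      rw [hz]; field_simp; ring
    have := h4 z hXz (hpos z hXz)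
    simp only [hcz] at *
    simp at *
    linarith
  obtain ⟨x₁, hx₁, hfx₁⟩ := hex
  filter_upwards [eventually_ge_atTop x₁] with x hx
  by_contra! hpos
  have hcont : ContinuousOn f (Icc x₁ x) := fun r hr =>
    (h1 r (hx₁.trans hr.1)).continuousAt.continuousWithinAt
  have hcl : IsClosed (Icc x₁ x ∩ f ⁻¹' Iic 0) :=
    hcont.preimage_isClosed_of_isClosed isClosed_Icc isClosed_Iic
  have hcomp : IsCompact (Icc x₁ x ∩ f ⁻¹' Iic 0) :=
    isCompact_Icc.of_isClosed_subset hcl inter_subset_left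
  obtain ⟨z, ⟨hzm, hz0⟩, hzg⟩ := hcomp.exists_isGreatest ⟨x₁, ⟨le_rfl, hx⟩, hfx₁⟩
  have := le_of_hasDerivAt_nonneg (f := fun r => -f r) (f' := fun r => -f' r) hzm.2
    (fun r hr => (h1 r (hx₁.trans (hzm.1.trans hr.1))).neg)
    (fun r hr => by
      have : 0 < f r := by
        by_contra! hr0
        exact absurd (hzg ⟨⟨hzm.1.trans hr.1.le, hr.2.le⟩, hr0⟩) (not_le.2 hr.1)
      have := h4 r (hx₁.trans (hzm.1.trans hr.1.le)) this
      linarith)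
  have hz0' : f z ≤ 0 := hz0
  linarith

/-- If a function with at most linear growth is uniformly convex wherever it is positive, then
it is eventually nonpositive. -/
lemma eventually_nonpos_of_linear_bound {f f' f'' : ℝ → ℝ} {X c C : ℝ} (hc : 0 < c)
    (h1 : ∀ x, X ≤ x → HasDerivAt f (f' x) x) (h2 : ∀ x, X ≤ x → HasDerivAt f' (f'' x) x)
    (h3 : ∀ x, X ≤ x → 0 < f x → c ≤ f'' x) (h4 : ∀ x, X ≤ x → f x ≤ C + x) :
    ∀ᶠ x in atTop, f x ≤ 0 := by
  refine eventually_nonpos_of_neg_deriv hc h1 h2 h3 fun x hx hpos => ?_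
  by_contra! hd
  set d := |C + x| + 2 / c + 1 with hdd
  have hcp : 0 < 2 / c := by positivity
  have hd1 : 1 ≤ d := by have := abs_nonneg (C + x); linarith
  have h5 := (quadratic_growth hc h1 h2 h3 hx hpos hd (x := x + (d + 2 / c)) (by linarith)).1
  have h6 := h4 (x + (d + 2 / c)) (by linarith)
  have h7 : C + x < d := by have := le_abs_self (C + x); linarith
  have h8 : c / 2 * (x + (d + 2 / c) - x) ^ 2 = (d + 2 / c) * (c / 2 * d + 1) := by
    field_simp; ring
  have h9 : 1 ≤ c / 2 * d := by
    have : 2 / c ≤ d := by have := abs_nonneg (C + x); linarith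
    rw [div_le_iff₀ hc] at this
    linarith
  nlinarith

/-- No function on a half-line is positive and nondecreasing, tends to infinity and satisfies
`f'' ≥ 2 f³`. -/
lemma no_global_supersolution {f f' f'' : ℝ → ℝ} {X : ℝ}
    (h1 : ∀ x, X ≤ x → HasDerivAt f (f' x) x) (h2 : ∀ x, X ≤ x → HasDerivAt f' (f'' x) x)
    (hpos : ∀ x, X ≤ x → 0 < f x) (hd : ∀ x, X ≤ x → 0 ≤ f' x)
    (h3 : ∀ x, X ≤ x → 2 * f x ^ 3 ≤ f'' x) (hlim : Tendsto f atTop atTop) : False := by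
  have hE : ∀ x, X ≤ x → f' X ^ 2 - f X ^ 4 ≤ f' x ^ 2 - f x ^ 4 := by
    intro x hx
    refine le_of_hasDerivAt_nonneg (f := fun r => f' r ^ 2 - f r ^ 4)
      (f' := fun r => ((2 : ℕ) : ℝ) * f' r ^ (2 - 1) * f'' r
        - ((4 : ℕ) : ℝ) * f r ^ (4 - 1) * f' r) hx
      (fun r hr => ((h2 r hr.1).pow 2).sub ((h1 r hr.1).pow 4)) (fun r hr => ?_)
    have a1 := h3 r hr.1.le
    have a2 := hd r hr.1.le
    norm_num
    nlinarith [mul_le_mul_of_nonneg_left a1 a2]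
  obtain ⟨x₁, hx₁⟩ := eventually_atTop.1
    ((hlim.eventually_ge_atTop (1 + 2 * f X ^ 4)).and (eventually_ge_atTop X))
  have hX₁ : X ≤ x₁ := (hx₁ x₁ le_rfl).2
  have hsq : ∀ x, x₁ ≤ x → f x ^ 2 / 2 ≤ f' x := by
    intro x hx
    have a1 := hE x (hX₁.trans hx)
    have a2 := (hx₁ x hx).1
    have a4 : 0 ≤ f X ^ 4 := by positivity
    have a3 : 1 + 2 * f X ^ 4 ≤ f x ^ 4 := by
      have b1 : 1 ≤ f x := by linarith
      have : f x ^ 1 ≤ f x ^ 4 := pow_le_pow_right₀ b1 (by norm_num)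
      linarith
    refine abs_le_of_sq_le_sq' ?_ (hd x (hX₁.trans hx)) |>.2
    nlinarith [sq_nonneg (f' X)]
  set z := x₁ + 2 / f x₁ with hz
  have hf₁ := hpos x₁ hX₁
  have hxz : x₁ ≤ z := by
    have : 0 < 2 / f x₁ := by positivity
    linarith
  have := le_of_hasDerivAt_nonneg (f := fun r => -(f r)⁻¹ - r / 2)
    (f' := fun r => -(-f' r / f r ^ 2) - 1 / 2) hxz
    (fun r hr => ((h1 r (hX₁.trans hr.1)).inv (hpos r (hX₁.trans hr.1)).ne').neg.sub
      ((hasDerivAt_id r).div_const 2))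
    (fun r hr => by
      have a1 := hsq r hr.1.le
      have a2 := hpos r (hX₁.trans hr.1.le)
      have : 1 / 2 ≤ f' r / f r ^ 2 := by
        rw [le_div_iff₀ (by positivity)]; linarith
      rw [neg_div, neg_neg]
      linarith)
  have a3 : 0 < (f z)⁻¹ := inv_pos.2 (hpos z (hX₁.trans hxz))
  have a4 : z / 2 = x₁ / 2 + (f x₁)⁻¹ := by rw [hz]; field_simp
  linarith

lemma hasDerivAt_const_div {k s : ℝ} (hs : s ≠ 0) :
    HasDerivAt (fun r : ℝ => k / r) (-k / s ^ 2) s := by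
  refine ((hasDerivAt_const s k).div (hasDerivAt_id s) hs).congr_deriv ?_
  simp

lemma hasDerivAt_neg_const_div_sq {k s : ℝ} (hs : s ≠ 0) :
    HasDerivAt (fun r : ℝ => -k / r ^ 2) (2 * k / s ^ 3) s := by
  refine ((hasDerivAt_const s (-k)).div ((hasDerivAt_id s).pow 2)
    (pow_ne_zero 2 hs)).congr_deriv ?_
  simp only [id, Pi.pow_apply]
  field_simp
  norm_num
  ring

/-- A bounded, eventually positive solution of Painlevé II behaves like `-α / s` at `+∞`. -/
lemma tendsto_mul_of_bounded_of_pos {α : ℝ} {y y' : ℝ → ℝ}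
    (h1 : ∀ s, HasDerivAt y (y' s) s) (h2 : ∀ s, HasDerivAt y' (s * y s + 2 * y s ^ 3 + α) s)
    {m M s₀ : ℝ} (hM : ∀ s, m ≤ s → |y s| ≤ M) (hpos : ∀ s, s₀ < s → 0 < y s) :
    Tendsto (fun s => s * y s) atTop (𝓝 (-α)) := by
  have hup : ∀ ε : ℝ, 0 < ε → ∀ᶠ s in atTop, s * y s ≤ -α + ε := by
    intro ε hε
    set k := -α + ε with hk
    obtain ⟨X, hX⟩ : ∃ X, ∀ x, X ≤ x → 1 ≤ x ∧ m ≤ x ∧ s₀ < x ∧ 4 * k / ε ≤ x :=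
      eventually_atTop.1 ((eventually_ge_atTop 1).and ((eventually_ge_atTop m).and
        ((eventually_gt_atTop s₀).and (eventually_ge_atTop (4 * k / ε)))))
    have := eventually_nonpos_of_linear_bound (f := fun s => y s - k / s)
      (f' := fun s => y' s - -k / s ^ 2)
      (f'' := fun s => s * y s + 2 * y s ^ 3 + α - 2 * k / s ^ 3)
      (X := X) (c := ε / 2) (C := M + |k|) (by positivity)
      (fun x hx => (h1 x).sub (hasDerivAt_const_div (by linarith [(hX x hx).1])))
      (fun x hx => (h2 x).sub (hasDerivAt_neg_const_div_sq (by linarith [(hX x hx).1])))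
      (fun x hx hf => by
        obtain ⟨a1, -, as, a2⟩ := hX x hx
        have a0 : 0 < x := by linarith
        have hy : k < x * y x := by
          have : k / x < y x := by linarith
          rw [div_lt_iff₀ a0] at this
          linarith
        rw [div_le_iff₀ hε] at a2
        have a3 : 2 * k / x ^ 3 ≤ ε / 2 := by
          rw [div_le_iff₀ (by positivity)]
          have : x ≤ x ^ 3 := by
            simpa using pow_le_pow_right₀ a1 (show 1 ≤ 3 by norm_num)
          nlinarith
        have a4 : 0 < y x ^ 3 := pow_pos (hpos x as) 3
        linarith)
      (fun x hx => by
        obtain ⟨a1, am, -, -⟩ := hX x hx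
        have a2 := (abs_le.1 (hM x am)).2
        have a3 : -(k / x) ≤ |k| := by
          rw [← neg_div, div_le_iff₀ (by linarith)]
          have := neg_le_abs k
          nlinarith [abs_nonneg k]
        linarith)
    filter_upwards [this, eventually_ge_atTop 1] with x hx hx1
    have : y x ≤ k / x := by linarith
    rw [le_div_iff₀ (by linarith)] at this
    linarith
  have hlow : ∀ ε : ℝ, 0 < ε → ∀ᶠ s in atTop, -α - ε ≤ s * y s := by
    intro ε hε
    set k := -α - ε with hk
    obtain ⟨X, hX⟩ : ∃ X, ∀ x, X ≤ x → 1 ≤ x ∧ s₀ < x ∧ 4 * |k| ^ 3 / ε ≤ x :=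
      eventually_atTop.1 ((eventually_ge_atTop 1).and
        ((eventually_gt_atTop s₀).and (eventually_ge_atTop (4 * |k| ^ 3 / ε))))
    have := eventually_nonpos_of_linear_bound (f := fun s => k / s - y s)
      (f' := fun s => -k / s ^ 2 - y' s)
      (f'' := fun s => 2 * k / s ^ 3 - (s * y s + 2 * y s ^ 3 + α))
      (X := X) (c := ε / 2) (C := |k|) (by positivity)
      (fun x hx => (hasDerivAt_const_div (by linarith [(hX x hx).1])).sub (h1 x))
      (fun x hx => (hasDerivAt_neg_const_div_sq (by linarith [(hX x hx).1])).sub (h2 x))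
      (fun x hx hf => by
        obtain ⟨a1, as, a2⟩ := hX x hx
        have a0 : 0 < x := by linarith
        have hyk : y x < k / x := by linarith
        have hy : x * y x < k := by
          rw [lt_div_iff₀ a0] at hyk
          linarith
        have hyp := hpos x as
        have hk0 : 0 < k := (mul_pos a0 hyp).trans hy
        rw [div_le_iff₀ hε, abs_of_pos hk0] at a2
        have a3 : 0 ≤ 2 * k / x ^ 3 := by positivity
        have a4 : y x ^ 3 ≤ (k / x) ^ 3 := pow_le_pow_left₀ hyp.le hyk.le 3
        have a5 : (k / x) ^ 3 ≤ ε / 4 := by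
          rw [div_pow, div_le_iff₀ (by positivity)]
          have : x ≤ x ^ 3 := by
            simpa using pow_le_pow_right₀ a1 (show 1 ≤ 3 by norm_num)
          nlinarith
        linarith)
      (fun x hx => by
        obtain ⟨a1, as, -⟩ := hX x hx
        have a3 : k / x ≤ |k| := by
          rw [div_le_iff₀ (by linarith)]
          have := le_abs_self k
          nlinarith [abs_nonneg k]
        have := hpos x as
        linarith)
    filter_upwards [this, eventually_ge_atTop 1] with x hx hx1
    have : k / x ≤ y x := by linarith
    rw [div_le_iff₀ (by linarith)] at this
    linarith
  rw [Metric.tendsto_nhds]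
  intro ε hε
  filter_upwards [hup (ε / 2) (by positivity), hlow (ε / 2) (by positivity)] with x h h'
  rw [Real.dist_eq, abs_lt]
  constructor <;> linarith

lemma hasDerivAt_sqrt_half {x : ℝ} (hx : 0 < x) :
    HasDerivAt (fun r => √(r / 2)) (1 / (4 * √(x / 2))) x := by
  refine (((hasDerivAt_id x).div_const 2).sqrt (by simp; linarith)).congr_deriv ?_
  simp only [id]
  field_simp
  norm_num

lemma hasDerivAt_deriv_sqrt_half {x : ℝ} (hx : 0 < x) :
    HasDerivAt (fun r => 1 / (4 * √(r / 2))) (-(1 / (16 * √(x / 2) ^ 3))) x := by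
  have hq : 0 < √(x / 2) := Real.sqrt_pos.2 (by linarith)
  refine ((hasDerivAt_const x (1 : ℝ)).div ((hasDerivAt_sqrt_half hx).const_mul 4)
    (by positivity)).congr_deriv ?_
  field_simp
  norm_num

/-- At a local minimum the second derivative is nonnegative. -/
lemma second_deriv_nonneg_of_isLocalMin {f f' : ℝ → ℝ} {c z : ℝ}
    (h1 : ∀ x, HasDerivAt f (f' x) x) (h2 : HasDerivAt f' c z) (hz : IsLocalMin f z) :
    0 ≤ c := by
  by_contra! hc
  have hd : deriv f = f' := funext fun x => (h1 x).deriv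
  have hmax : IsLocalMax f z := by
    apply isLocalMax_of_deriv_deriv_neg
    · rwa [hd, h2.deriv]
    · exact hz.deriv_eq_zero
    · exact (h1 z).continuousAt
  have heq : f =ᶠ[𝓝 z] fun _ => f z := by
    filter_upwards [hz, hmax] with x a b using le_antisymm b a
  have : f' =ᶠ[𝓝 z] fun _ => 0 := by
    have := heq.deriv
    rw [hd] at this
    simpa using this
  have := this.deriv_eq
  rw [h2.deriv] at this
  simp at this
  linarith

/-- A global solution that is eventually positive is eventually below `√(x / 2) + ε`. -/
lemma eventually_le_sqrt_add {β : ℝ} (hβ : 0 ≤ β) {u u' : ℝ → ℝ}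
    (h1 : ∀ x, HasDerivAt u (u' x) x) (h2 : ∀ x, HasDerivAt u' (2 * u x ^ 3 - x * u x + β) x)
    {ε : ℝ} (hε : 0 < ε) : ∀ᶠ x in atTop, u x ≤ √(x / 2) + ε := by
  have d1 : ∀ x, 1 ≤ x → HasDerivAt (fun r => u r - √(r / 2) - ε)
      (u' x - 1 / (4 * √(x / 2))) x := fun x hx =>
    ((h1 x).sub (hasDerivAt_sqrt_half (by linarith))).sub_const ε
  have d2 : ∀ x, 1 ≤ x → HasDerivAt (fun r => u' r - 1 / (4 * √(r / 2)))
      (2 * u x ^ 3 - x * u x + β - -(1 / (16 * √(x / 2) ^ 3))) x := fun x hx =>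
    (h2 x).sub (hasDerivAt_deriv_sqrt_half (by linarith))
  have d3 : ∀ x, 1 ≤ x → 0 < u x - √(x / 2) - ε →
      2 * (u x - √(x / 2) - ε) ^ 3 + 2 * ε ^ 3 ≤
        2 * u x ^ 3 - x * u x + β - -(1 / (16 * √(x / 2) ^ 3)) := by
    intro x hx hpos
    have hq : 0 < √(x / 2) := Real.sqrt_pos.2 (by linarith)
    have hsq : √(x / 2) ^ 2 = x / 2 := Real.sq_sqrt (by linarith)
    set q := √(x / 2)
    have hx2 : x = 2 * q ^ 2 := by linarith
    obtain ⟨h, hh⟩ : ∃ h, h = u x - q - ε := ⟨_, rfl⟩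
    have hu : u x = h + q + ε := by linarith
    have h3 : 0 ≤ 1 / (16 * q ^ 3) := by positivity
    rw [← hh] at hpos ⊢
    have : 2 * h ^ 3 + 2 * ε ^ 3 ≤ 2 * u x ^ 3 - x * u x := by
      have e : 2 * u x ^ 3 - x * u x - (2 * h ^ 3 + 2 * ε ^ 3) =
          6 * h ^ 2 * q + 6 * h ^ 2 * ε + 6 * h * ε ^ 2 + 6 * q * ε ^ 2 + 12 * h * q * ε
            + 4 * q ^ 2 * h + 4 * q ^ 2 * ε := by
        rw [hu, hx2]; ring
      have : 0 ≤ 6 * h ^ 2 * q + 6 * h ^ 2 * ε + 6 * h * ε ^ 2 + 6 * q * ε ^ 2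
          + 12 * h * q * ε + 4 * q ^ 2 * h + 4 * q ^ 2 * ε := by positivity
      linarith
    linarith
  have d4 : ∀ x, 1 ≤ x → 0 < u x - √(x / 2) - ε →
      2 * ε ^ 3 ≤ 2 * u x ^ 3 - x * u x + β - -(1 / (16 * √(x / 2) ^ 3)) := by
    intro x hx hpos
    have := d3 x hx hpos
    have := pow_pos hpos 3
    linarith
  have := eventually_nonpos_of_neg_deriv (c := 2 * ε ^ 3) (by positivity) d1 d2 d4
    (fun x hx hpos => by
      by_contra! hd
      have grow := fun {r} (hr : x ≤ r) =>
        quadratic_growth (by positivity) d1 d2 d4 hx hpos hd hr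
      have hp : ∀ r, x ≤ r → 0 < u r - √(r / 2) - ε := fun r hr => by
        have a := (grow hr).1
        have : 0 ≤ 2 * ε ^ 3 / 2 * (r - x) ^ 2 := by positivity
        linarith
      refine no_global_supersolution (X := x) (fun r hr => d1 r (hx.trans hr))
        (fun r hr => d2 r (hx.trans hr)) hp (fun r hr => ?_) (fun r hr => ?_) ?_
      · exact le_trans (mul_nonneg (by positivity) (by linarith)) (grow hr).2
      · have := d3 r (hx.trans hr) (hp r hr)
        have : 0 < ε ^ 3 := by positivity
        linarith
      · have hlim : Tendsto (fun r : ℝ => 2 * ε ^ 3 / 2 * (r - x) ^ 2) atTop atTop :=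
          Tendsto.const_mul_atTop (by positivity)
            ((tendsto_pow_atTop two_ne_zero).comp (tendsto_atTop_add_const_right _ (-x) tendsto_id))
        refine tendsto_atTop_mono' _ ?_ hlim
        filter_upwards [eventually_ge_atTop x] with r hr
        have := (grow hr).1
        linarith)
  filter_upwards [this] with x hx
  linarith

/-- A positive solution with enough points where `6 u² - x` is bounded below has no critical
point with a small value far to the right. -/
lemma eventually_one_lt_of_critical {β M : ℝ} (hβ : 0 ≤ β) {u u' : ℝ → ℝ}
    (h1 : ∀ x, HasDerivAt u (u' x) x) (h2 : ∀ x, HasDerivAt u' (2 * u x ^ 3 - x * u x + β) x)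
    (hpos : ∀ᶠ x in atTop, 0 < u x)
    (hM : ∀ᶠ x in atTop, ∃ z ∈ Icc x (x + 1), z - M ≤ 6 * u z ^ 2) :
    ∀ᶠ x in atTop, u' x = 0 → 1 < u x := by
  have hsq : ∀ᶠ x in atTop, u x ^ 2 ≤ 3 / 4 * x := by
    filter_upwards [eventually_le_sqrt_add hβ h1 h2 one_pos, hpos, eventually_ge_atTop 50]
      with x hx hx0 hx50
    have hq : 0 ≤ √(x / 2) := Real.sqrt_nonneg _
    have hqs : √(x / 2) ^ 2 = x / 2 := Real.sq_sqrt (by linarith)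
    have hq5 : 5 ≤ √(x / 2) := Real.le_sqrt_of_sq_le (by linarith)
    have : u x ^ 2 ≤ (√(x / 2) + 1) ^ 2 := pow_le_pow_left₀ hx0.le hx 2
    nlinarith
  obtain ⟨X, hX⟩ := eventually_atTop.1 (hsq.and hpos)
  filter_upwards [hM, eventually_ge_atTop X, eventually_ge_atTop 1,
    eventually_ge_atTop (|M| * 2 + 96 * (β + 2) + 100)] with z ⟨b, hb, hbM⟩ hzX hz1 hzl hcrit
  by_contra! hu1
  have hu0 : 0 < u z := (hX z hzX).2
  have hF := le_of_hasDerivAt_nonneg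
    (f := fun r => 3 / 8 * (z + 1) * r - (u' r ^ 2 / 2 + r * u r ^ 2 / 2 - u r ^ 4 / 2 - β * u r))
    (f' := fun r => 3 / 8 * (z + 1) - u r ^ 2 / 2) hb.1
    (fun r _ => by
      refine (((hasDerivAt_id r).const_mul (3 / 8 * (z + 1))).sub
        ((((((h2 r).pow 2).div_const 2).add
          (((hasDerivAt_id r).mul ((h1 r).pow 2)).div_const 2)).sub
          (((h1 r).pow 4).div_const 2)).sub ((h1 r).const_mul β))).congr_deriv ?_
      simp only [id, Pi.pow_apply]
      norm_num
      ring)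
    (fun r hr => by
      have a1 := (hX r (hzX.trans hr.1.le)).1
      have a2 : r ≤ z + 1 := hr.2.le.trans hb.2
      linarith)
  simp only [hcrit] at hF
  obtain ⟨hb1, hb2⟩ := hb
  have b1 := (hX b (hzX.trans hb1)).1
  have b2 := (hX b (hzX.trans hb1)).2
  have hz4 : 0 ≤ u z ^ 4 := by positivity
  have hzs : u z ^ 2 ≤ 1 := by nlinarith
  have hzF : z * u z ^ 2 ≤ z := by nlinarith
  have hβz : 0 ≤ β * u z := by positivity
  have hb' : 0 ≤ u' b ^ 2 := sq_nonneg _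
  have hub : u b ≤ b + 1 := by nlinarith [sq_nonneg (u b - 1)]
  have hβb : β * u b ≤ β * (b + 1) := mul_le_mul_of_nonneg_left hub hβ
  have hbM' : b / 2 ≤ 6 * u b ^ 2 := by
    have := le_abs_self M
    have := abs_nonneg M
    linarith
  have hlow : b * b / 96 ≤ b * u b ^ 2 / 2 - u b ^ 4 / 2 := by
    have : u b ^ 4 = u b ^ 2 * u b ^ 2 := by ring
    rw [this]
    nlinarith
  have hMn := abs_nonneg M
  have h100 : 96 * (β + 2) + 100 ≤ b := by linarith
  nlinarith

/-- A continuous function takes a value not above `u x`, for `x ∈ [a, b]`, at an endpoint or at a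
local minimum in `[a, b]`. -/
lemma exists_isLocalMin_or_endpoint {u : ℝ → ℝ} (hu : Continuous u) {a b x : ℝ}
    (hx : x ∈ Icc a b) : ∃ z ∈ Icc a b, u z ≤ u x ∧ (z = a ∨ z = b ∨ IsLocalMin u z) := by
  obtain ⟨z, hz, hmin⟩ := isCompact_Icc.exists_isMinOn ⟨x, hx⟩ hu.continuousOn
  refine ⟨z, hz, hmin hx, ?_⟩
  rcases eq_or_lt_of_le hz.1 with h | h
  · exact Or.inl h.symm
  rcases eq_or_lt_of_le hz.2 with h' | h'
  · exact Or.inr (Or.inl h')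
  · exact Or.inr (Or.inr (hmin.isLocalMin (Icc_mem_nhds h h')))

/-- A positive solution with enough points where `6 u² - x` is bounded below is asymptotic to
`√(x / 2)`. -/
lemma tendsto_sub_sqrt_half {β M : ℝ} (hβ : 0 ≤ β) {u u' : ℝ → ℝ}
    (h1 : ∀ x, HasDerivAt u (u' x) x) (h2 : ∀ x, HasDerivAt u' (2 * u x ^ 3 - x * u x + β) x)
    (hpos : ∀ᶠ x in atTop, 0 < u x)
    (hM : ∀ᶠ x in atTop, ∃ z ∈ Icc x (x + 1), z - M ≤ 6 * u z ^ 2) :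
    Tendsto (fun x => u x - √(x / 2)) atTop (𝓝 0) := by
  have hcont : Continuous u := continuous_iff_continuousAt.2 fun x => (h1 x).continuousAt
  have hwindow : ∀ᶠ x in atTop, ∃ a b, x - 2 ≤ a ∧ x ∈ Icc a b ∧ a - M ≤ 6 * u a ^ 2 ∧
      b - M ≤ 6 * u b ^ 2 := by
    filter_upwards [(tendsto_atTop_add_const_right atTop (-2 : ℝ) tendsto_id).eventually hM, hM]
      with x ⟨a, ha, ha'⟩ ⟨b, hb, hb'⟩
    simp only [id] at ha
    exact ⟨a, b, by linarith [ha.1], ⟨by linarith [ha.2], hb.1⟩, ha', hb'⟩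
  obtain ⟨X, hX⟩ := eventually_atTop.1
    ((eventually_one_lt_of_critical hβ h1 h2 hpos hM).and hpos)
  have hone : ∀ᶠ x in atTop, 1 < u x := by
    filter_upwards [hwindow, eventually_ge_atTop (X + 2), eventually_ge_atTop (M + 9)]
      with x ⟨a, b, hxa, hx, ha, hb⟩ hxX hxM
    obtain ⟨z, hz, hzx, hcase⟩ := exists_isLocalMin_or_endpoint hcont hx
    have hzX : X ≤ z := by linarith [hz.1]
    have hz0 : 0 < u z := (hX z hzX).2
    refine lt_of_lt_of_le ?_ hzx
    rcases hcase with rfl | rfl | h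
    · nlinarith
    · nlinarith [hx.2]
    · exact (hX z hzX).1 (h.hasDerivAt_eq_zero (h1 z))
  obtain ⟨Y, hY⟩ := eventually_atTop.1 hone
  have heighth : ∀ᶠ x in atTop, x / 8 ≤ u x ^ 2 := by
    filter_upwards [hwindow, eventually_ge_atTop (Y + 2), eventually_ge_atTop (2 : ℝ),
      eventually_ge_atTop (4 * (|M| + β + 2))] with x ⟨a, b, hxa, hx, ha, hb⟩ hxY hx2 hxM
    obtain ⟨z, hz, hzx, hcase⟩ := exists_isLocalMin_or_endpoint hcont hx
    have hz1 : 1 < u z := hY z (by linarith [hz.1])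
    have hzz : x - 2 ≤ z := hxa.trans hz.1
    have hMa := le_abs_self M
    have hMn := abs_nonneg M
    have hsq : u z ^ 2 ≤ u x ^ 2 := pow_le_pow_left₀ (by linarith) hzx 2
    refine le_trans ?_ hsq
    rcases hcase with rfl | rfl | h
    · linarith
    · linarith
    · have := second_deriv_nonneg_of_isLocalMin h1 (h2 z) h
      have : z - 2 * u z ^ 2 ≤ β := by
        by_contra! hlt
        nlinarith
      linarith
  rw [Metric.tendsto_nhds]
  intro ε hε
  have hlow : ∀ᶠ x in atTop, √(x / 2) - u x - ε / 2 ≤ 0 := by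
    obtain ⟨Z, hZ⟩ := eventually_atTop.1 (heighth.and (hpos.and
      ((eventually_ge_atTop 1).and (eventually_ge_atTop ((β + 2) * 4 / ε)))))
    refine eventually_nonpos_of_linear_bound (X := Z) (c := 1) (C := 0) one_pos
      (f' := fun x => 1 / (4 * √(x / 2)) - u' x)
      (f'' := fun x => -(1 / (16 * √(x / 2) ^ 3)) - (2 * u x ^ 3 - x * u x + β))
      (fun x hx => ?_) (fun x hx => ?_) (fun x hx hgt => ?_) (fun x hx => ?_)
    · obtain ⟨-, -, hx1, -⟩ := hZ x hx
      exact ((hasDerivAt_sqrt_half (by linarith)).sub (h1 x)).sub_const _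
    · obtain ⟨-, -, hx1, -⟩ := hZ x hx
      exact (hasDerivAt_deriv_sqrt_half (by linarith)).sub (h2 x)
    · obtain ⟨hx8, hx0, hx1, hxe⟩ := hZ x hx
      have hqs : √(x / 2) ^ 2 = x / 2 := Real.sq_sqrt (by linarith)
      have hq : 0 < √(x / 2) := Real.sqrt_pos.2 (by linarith)
      set q := √(x / 2)
      have hqh : 1 / 2 ≤ q := by nlinarith
      have hq3 : 1 / (16 * q ^ 3) ≤ 1 := by
        rw [div_le_one (by positivity)]
        have : (1 / 2 : ℝ) ^ 3 ≤ q ^ 3 := pow_le_pow_left₀ (by norm_num) hqh 3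
        linarith
      have huq : q / 2 ≤ u x := by nlinarith
      rw [div_le_iff₀ hε] at hxe
      have hx2 : x = 2 * q ^ 2 := by linarith
      have e : -(2 * u x ^ 3 - x * u x + β) = 2 * (u x * (q + u x)) * (q - u x) - β := by
        rw [hx2]; ring
      have f1 : q / 2 * q ≤ u x * (q + u x) := by
        apply mul_le_mul huq (by linarith) hq.le hx0.le
      have f2 : 2 * (q / 2 * q) * (ε / 2) ≤ 2 * (u x * (q + u x)) * (q - u x) := by
        apply mul_le_mul (by linarith) (by linarith) (by positivity) (by positivity)
      have f3 : 2 * (q / 2 * q) * (ε / 2) = x * ε / 4 := by rw [hx2]; ring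
      linarith
    · obtain ⟨-, hx0, hx1, -⟩ := hZ x hx
      have : √(x / 2) ≤ x := by
        rw [Real.sqrt_le_left (by linarith)]
        nlinarith
      linarith
  filter_upwards [eventually_le_sqrt_add hβ h1 h2 (half_pos hε), hlow] with x h h'
  rw [Real.dist_eq, abs_lt]
  constructor <;> linarith

lemma PainleveSol.contDiff_infty {α : ℝ} {y : ℝ → ℝ} (hy : PainleveSol α y) :
    ContDiff ℝ (⊤ : ℕ∞) y := by
  have key : ∀ n : ℕ, ContDiff ℝ ((n + 1 : ℕ) : WithTop ℕ∞) y := by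
    intro n
    induction n with
    | zero => exact hy.1.of_le (by norm_num)
    | succ n ih =>
      have hd : deriv (deriv y) = fun s => s * y s + 2 * y s ^ 3 + α := funext hy.2
      have hdiff : Differentiable ℝ (deriv y) := by
        have := hy.1.iterate_deriv' 1 1
        exact this.differentiable (by norm_num)
      have h2 : ContDiff ℝ ((n + 1 : ℕ) : WithTop ℕ∞) (deriv y) := by
        push_cast
        rw [contDiff_succ_iff_deriv]
        refine ⟨hdiff, fun h => by simp at h, ?_⟩
        rw [hd]
        have ih' : ContDiff ℝ ((n : ℕ) : WithTop ℕ∞) y :=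
          ih.of_le (by exact_mod_cast Nat.le_succ n)
        fun_prop
      push_cast at h2 ⊢
      rw [contDiff_succ_iff_deriv]
      exact ⟨hy.1.differentiable (by norm_num), fun h => by simp [WithTop.add_eq_top] at h, h2⟩
  rw [_root_.contDiff_infty]
  exact fun n => (key n).of_le (by exact_mod_cast Nat.le_succ n)

lemma PainleveSol.hasDerivAt {α : ℝ} {y : ℝ → ℝ} (hy : PainleveSol α y) (s : ℝ) :
    HasDerivAt y (deriv y s) s :=
  (hy.1.differentiable (by norm_num) s).hasDerivAt

lemma PainleveSol.hasDerivAt_deriv {α : ℝ} {y : ℝ → ℝ} (hy : PainleveSol α y) (s : ℝ) :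
    HasDerivAt (deriv y) (s * y s + 2 * y s ^ 3 + α) s := by
  have : Differentiable ℝ (deriv y) := (hy.1.iterate_deriv' 1 1).differentiable (by norm_num)
  rw [← hy.2 s]
  exact (this s).hasDerivAt

/-- A continuous function that vanishes where `φ` and its derivative do is integrable if `φ` has
compact support. -/
lemma integrable_of_eq_zero_off_support {φ f : ℝ → ℝ} (hφ : HasCompactSupport φ)
    (hf : Continuous f) (h0 : ∀ s, φ s = 0 → deriv φ s = 0 → f s = 0) : Integrable f := by
  refine hf.integrable_of_hasCompactSupport (hφ.mono' fun s hs => ?_)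
  by_contra hn
  have h1 : φ s = 0 := image_eq_zero_of_notMem_tsupport hn
  have h2 : deriv φ s = 0 := by
    by_contra h
    exact hn (support_deriv_subset h)
  exact hs (h0 s h1 h2)

/-- The energy increment of a minimal solution is nonnegative. -/
lemma MinimalSol.increment_nonneg {α : ℝ} {y : ℝ → ℝ} (hy : MinimalSol α y) {φ : ℝ → ℝ}
    (hφ : ContDiff ℝ (⊤ : ℕ∞) φ) (hc : HasCompactSupport φ) :
    0 ≤ ∫ s, (deriv φ s ^ 2 / 2 + s * φ s ^ 2 / 2 + 3 * y s ^ 2 * φ s ^ 2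
      + 2 * y s * φ s ^ 3 + φ s ^ 4 / 2) := by
  have hmin := hy.2 φ hφ hc
  have hys := hy.1
  have cy : Continuous y := hys.1.continuous
  have cdy : Continuous (deriv y) := hys.1.continuous_deriv (by norm_num)
  have cφ : Continuous φ := hφ.continuous
  have cdφ : Continuous (deriv φ) := hφ.continuous_deriv (by simp)
  have dφ : ∀ s, HasDerivAt φ (deriv φ s) s := fun s =>
    (hφ.differentiable (by simp) s).hasDerivAt
  have dsum : ∀ s, deriv (fun r => y r + φ r) s = deriv y s + deriv φ s := fun s =>
    ((hys.hasDerivAt s).add (dφ s)).deriv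
  unfold EPII at hmin
  simp only [dsum] at hmin
  rw [← sub_nonneg, ← integral_sub] at hmin
  rotate_left
  · exact (by fun_prop : Continuous _).continuousOn.integrableOn_compact hc
  · exact (by fun_prop : Continuous _).continuousOn.integrableOn_compact hc
  rw [setIntegral_eq_integral_of_forall_compl_eq_zero] at hmin
  swap
  · intro s hs
    have h1 : φ s = 0 := image_eq_zero_of_notMem_tsupport hs
    have h2 : deriv φ s = 0 := by
      by_contra h
      exact hs (support_deriv_subset h)
    simp [h1, h2]
  have hzero : ∫ s, ((s * y s + 2 * y s ^ 3 + α) * φ s + deriv y s * deriv φ s) = 0 := by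
    refine integral_eq_zero_of_hasDerivAt_of_integrable (f := fun s => deriv y s * φ s)
      (fun s => (hys.hasDerivAt_deriv s).mul (dφ s)) ?_ ?_
    · exact integrable_of_eq_zero_off_support hc (by fun_prop) (fun s h1 h2 => by simp [h1, h2])
    · exact integrable_of_eq_zero_off_support hc (by fun_prop) (fun s h1 h2 => by simp [h1])
  have hsplit : ∀ s, 1 / 2 * (deriv y s + deriv φ s) ^ 2 + 1 / 2 * s * (y s + φ s) ^ 2
        + 1 / 2 * (y s + φ s) ^ 4 + α * (y s + φ s)
      - (1 / 2 * deriv y s ^ 2 + 1 / 2 * s * y s ^ 2 + 1 / 2 * y s ^ 4 + α * y s)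
      = (deriv φ s ^ 2 / 2 + s * φ s ^ 2 / 2 + 3 * y s ^ 2 * φ s ^ 2
        + 2 * y s * φ s ^ 3 + φ s ^ 4 / 2)
        + ((s * y s + 2 * y s ^ 3 + α) * φ s + deriv y s * deriv φ s) := by
    intro s; ring
  simp only [hsplit] at hmin
  rwa [integral_add, hzero, add_zero] at hmin
  · exact integrable_of_eq_zero_off_support hc (by fun_prop) (fun s h1 h2 => by simp [h1, h2])
  · exact integrable_of_eq_zero_off_support hc (by fun_prop) (fun s h1 h2 => by simp [h1, h2])

/-- The second variation of the energy at a minimal solution is nonnegative. -/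
lemma MinimalSol.second_variation_nonneg {α : ℝ} {y : ℝ → ℝ} (hy : MinimalSol α y) {φ : ℝ → ℝ}
    (hφ : ContDiff ℝ (⊤ : ℕ∞) φ) (hc : HasCompactSupport φ) :
    0 ≤ ∫ s, (deriv φ s ^ 2 + (s + 6 * y s ^ 2) * φ s ^ 2) := by
  have cy : Continuous y := hy.1.1.continuous
  have cφ : Continuous φ := hφ.continuous
  have cdφ : Continuous (deriv φ) := hφ.continuous_deriv (by simp)
  have iA : Integrable fun s => deriv φ s ^ 2 + (s + 6 * y s ^ 2) * φ s ^ 2 :=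
    integrable_of_eq_zero_off_support hc (by fun_prop) (fun s h1 h2 => by simp [h1, h2])
  have iB : Integrable fun s => y s * φ s ^ 3 :=
    integrable_of_eq_zero_off_support hc (by fun_prop) (fun s h1 h2 => by simp [h1])
  have iC : Integrable fun s => φ s ^ 4 :=
    integrable_of_eq_zero_off_support hc (by fun_prop) (fun s h1 h2 => by simp [h1])
  have key : ∀ t : ℝ, 0 < t → 0 ≤ (∫ s, (deriv φ s ^ 2 + (s + 6 * y s ^ 2) * φ s ^ 2))
      + 4 * t * (∫ s, y s * φ s ^ 3) + t ^ 2 * ∫ s, φ s ^ 4 := by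
    intro t ht
    have h := hy.increment_nonneg (φ := fun s => t * φ s) (by fun_prop) hc.mul_left
    have hd : ∀ s, deriv (fun r => t * φ r) s = t * deriv φ s := fun s =>
      deriv_const_mul t (hφ.differentiable (by simp) s)
    simp only [hd] at h
    have e : ∀ s, (t * deriv φ s) ^ 2 / 2 + s * (t * φ s) ^ 2 / 2 + 3 * y s ^ 2 * (t * φ s) ^ 2
        + 2 * y s * (t * φ s) ^ 3 + (t * φ s) ^ 4 / 2
        = t ^ 2 / 2 * (((deriv φ s ^ 2 + (s + 6 * y s ^ 2) * φ s ^ 2)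
          + 4 * t * (y s * φ s ^ 3)) + t ^ 2 * φ s ^ 4) := by intro s; ring
    simp only [e] at h
    have iAB : Integrable fun s => deriv φ s ^ 2 + (s + 6 * y s ^ 2) * φ s ^ 2
        + 4 * t * (y s * φ s ^ 3) := iA.add (iB.const_mul (4 * t))
    rw [integral_const_mul, integral_add iAB (iC.const_mul _),
      integral_add iA (iB.const_mul _), integral_const_mul, integral_const_mul] at h
    exact nonneg_of_mul_nonneg_right h (by positivity)
  have hlim : Tendsto (fun t : ℝ => (∫ s, (deriv φ s ^ 2 + (s + 6 * y s ^ 2) * φ s ^ 2))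
      + 4 * t * (∫ s, y s * φ s ^ 3) + t ^ 2 * ∫ s, φ s ^ 4) (𝓝[>] 0)
      (𝓝 (∫ s, (deriv φ s ^ 2 + (s + 6 * y s ^ 2) * φ s ^ 2))) := by
    have : Continuous (fun t : ℝ => (∫ s, (deriv φ s ^ 2 + (s + 6 * y s ^ 2) * φ s ^ 2))
      + 4 * t * (∫ s, y s * φ s ^ 3) + t ^ 2 * ∫ s, φ s ^ 4) := by fun_prop
    have := this.tendsto 0
    simp only [mul_zero, zero_mul, add_zero, ne_eq, OfNat.ofNat_ne_zero, not_false_eq_true,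
      zero_pow] at this
    exact this.mono_left nhdsWithin_le_nhds
  exact ge_of_tendsto hlim (by filter_upwards [self_mem_nhdsWithin] with t ht using key t ht)

/-- In every unit interval there is a point at which the linearized potential of a minimal
solution is not too negative. -/
lemma MinimalSol.exists_lower_bound {α : ℝ} {y : ℝ → ℝ} (hy : MinimalSol α y) :
    ∃ M : ℝ, ∀ x, ∃ z ∈ Icc x (x + 1), -M ≤ z + 6 * y z ^ 2 := by
  let ψ : ContDiffBump (1 / 2 : ℝ) := ⟨1 / 4, 1 / 2, by norm_num, by norm_num⟩
  have hψ : ContDiff ℝ (⊤ : ℕ∞) ψ := ψ.contDiff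
  have hψc : HasCompactSupport ψ := ψ.hasCompactSupport
  have cψ : Continuous ψ := hψ.continuous
  have cdψ : Continuous (deriv ψ) := hψ.continuous_deriv (by simp)
  have iψ : Integrable fun s => ψ s ^ 2 :=
    integrable_of_eq_zero_off_support hψc (by fun_prop) (fun s h1 h2 => by simp [h1])
  have idψ : Integrable fun s => deriv ψ s ^ 2 :=
    integrable_of_eq_zero_off_support hψc (by fun_prop) (fun s h1 h2 => by simp [h2])
  have hpos : 0 < ∫ s, ψ s ^ 2 := by
    refine (by fun_prop : Continuous fun s => ψ s ^ 2).integral_pos_of_hasCompactSupport_nonneg_nonzero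
      (x := 1 / 2) ?_ (fun s => by positivity) ?_
    · exact hψc.mono fun s hs h => hs (by simp [h])
    · have : ψ (1 / 2) = 1 := ψ.one_of_mem_closedBall (by simp [ψ])
      rw [this]
      norm_num
  set P := ∫ s, ψ s ^ 2
  set Q := ∫ s, deriv ψ s ^ 2
  refine ⟨Q / P + 1, fun x => ?_⟩
  by_contra! hneg
  have hφ : ContDiff ℝ (⊤ : ℕ∞) fun s => ψ (s - x) := by fun_prop
  have hφc : HasCompactSupport fun s => ψ (s - x) :=
    hψc.comp_homeomorph (Homeomorph.subRight x)
  have h := hy.second_variation_nonneg hφ hφc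
  have hd : ∀ s, deriv (fun r => ψ (r - x)) s = deriv ψ (s - x) := fun s =>
    deriv_comp_sub_const (f := ψ) ..
  have cy : Continuous y := hy.1.1.continuous
  have iA : Integrable fun s => deriv (fun r => ψ (r - x)) s ^ 2
      + (s + 6 * y s ^ 2) * ψ (s - x) ^ 2 :=
    integrable_of_eq_zero_off_support hφc (by simp only [hd]; fun_prop)
      (fun s h1 h2 => by rw [h1, h2]; simp)
  have hle : ∫ s, (deriv (fun r => ψ (r - x)) s ^ 2 + (s + 6 * y s ^ 2) * ψ (s - x) ^ 2)
      ≤ ∫ s, (deriv ψ (s - x) ^ 2 - (Q / P + 1) * ψ (s - x) ^ 2) := by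
    refine integral_mono iA ((idψ.comp_sub_right x).sub ((iψ.comp_sub_right x).const_mul _))
      fun s => ?_
    simp only [hd]
    by_cases hs : s ∈ Icc x (x + 1)
    · have := hneg s hs
      nlinarith [sq_nonneg (ψ (s - x))]
    · have : ψ (s - x) = 0 := by
        apply ψ.zero_of_le_dist
        rw [Real.dist_eq]
        change 1 / 2 ≤ _
        by_contra! hlt
        rw [abs_lt] at hlt
        exact hs ⟨by linarith, by linarith⟩
      simp [this]
  rw [integral_sub (idψ.comp_sub_right x) ((iψ.comp_sub_right x).const_mul _),
    integral_const_mul, integral_sub_right_eq_self (fun s => deriv ψ s ^ 2),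
    integral_sub_right_eq_self (fun s => ψ s ^ 2)] at hle
  have : (Q / P + 1) * P = Q + P := by field_simp
  change _ ≤ Q - (Q / P + 1) * P at hle
  linarith

/-- The energy increment obtained by reflecting a minimal solution with a cutoff `η`. -/
lemma MinimalSol.reflection_increment_nonneg {α : ℝ} {y : ℝ → ℝ} (hy : MinimalSol α y)
    {η : ℝ → ℝ} (hη : ContDiff ℝ (⊤ : ℕ∞) η) (hc : HasCompactSupport η) :
    0 ≤ ∫ s, (2 * (deriv η s * y s) ^ 2 + -2 * α * (η s ^ 2 * y s)
      + 8 * y s ^ 4 * (η s ^ 2 * (1 - η s) ^ 2)) := by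
  have hys := hy.1
  have sy := hys.contDiff_infty
  have cy : Continuous y := hys.1.continuous
  have cdy : Continuous (deriv y) := hys.1.continuous_deriv (by norm_num)
  have cη : Continuous η := hη.continuous
  have cdη : Continuous (deriv η) := hη.continuous_deriv (by simp)
  have dη : ∀ s, HasDerivAt η (deriv η s) s := fun s =>
    (hη.differentiable (by simp) s).hasDerivAt
  have h := hy.increment_nonneg (φ := fun s => -2 * (η s * y s)) (by fun_prop)
    (hc.mul_right.mul_left)
  have hd : ∀ s, deriv (fun r => -2 * (η r * y r)) s
      = -2 * (deriv η s * y s + η s * deriv y s) := fun s =>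
    (((dη s).mul (hys.hasDerivAt s)).const_mul (-2)).deriv
  simp only [hd] at h
  have hzero : ∫ s, (4 * η s * deriv η s * y s * deriv y s + 2 * η s ^ 2 * deriv y s ^ 2
      + 2 * η s ^ 2 * y s * (s * y s + 2 * y s ^ 3 + α)) = 0 := by
    refine integral_eq_zero_of_hasDerivAt_of_integrable
      (f := fun s => 2 * (η s ^ 2 * (y s * deriv y s))) (fun s => ?_) ?_ ?_
    · refine ((((dη s).pow 2).mul ((hys.hasDerivAt s).mul
        (hys.hasDerivAt_deriv s))).const_mul 2).congr_deriv ?_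
      simp only [Pi.pow_apply, Pi.mul_apply]
      norm_num
      ring
    · exact integrable_of_eq_zero_off_support hc (by fun_prop) (fun s h1 h2 => by simp [h1])
    · exact integrable_of_eq_zero_off_support hc (by fun_prop) (fun s h1 h2 => by simp [h1])
  have hsplit : ∀ s, (-2 * (deriv η s * y s + η s * deriv y s)) ^ 2 / 2
        + s * (-2 * (η s * y s)) ^ 2 / 2 + 3 * y s ^ 2 * (-2 * (η s * y s)) ^ 2
        + 2 * y s * (-2 * (η s * y s)) ^ 3 + (-2 * (η s * y s)) ^ 4 / 2
      = (2 * (deriv η s * y s) ^ 2 + -2 * α * (η s ^ 2 * y s)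
        + 8 * y s ^ 4 * (η s ^ 2 * (1 - η s) ^ 2))
        + (4 * η s * deriv η s * y s * deriv y s + 2 * η s ^ 2 * deriv y s ^ 2
          + 2 * η s ^ 2 * y s * (s * y s + 2 * y s ^ 3 + α)) := by
    intro s; ring
  simp only [hsplit] at h
  rwa [integral_add, hzero, add_zero] at h
  · exact integrable_of_eq_zero_off_support hc (by fun_prop) (fun s h1 h2 => by simp [h1, h2])
  · exact integrable_of_eq_zero_off_support hc (by fun_prop) (fun s h1 h2 => by simp [h1])

lemma deriv_smoothTransition_eq_zero {t : ℝ} (ht : t < 0 ∨ 1 < t) :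
    deriv Real.smoothTransition t = 0 := by
  rcases ht with ht | ht
  · have : Real.smoothTransition =ᶠ[𝓝 t] fun _ => 0 := by
      filter_upwards [gt_mem_nhds ht] with r hr using Real.smoothTransition.zero_of_nonpos hr.le
    simpa using this.deriv_eq
  · have : Real.smoothTransition =ᶠ[𝓝 t] fun _ => 1 := by
      filter_upwards [lt_mem_nhds ht] with r hr using Real.smoothTransition.one_of_one_le hr.le
    simpa using this.deriv_eq

lemma exists_bound_deriv_smoothTransition :
    ∃ C : ℝ, 0 ≤ C ∧ ∀ t, |deriv Real.smoothTransition t * (t + 1)| ≤ C := by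
  have hcont : Continuous fun t => deriv Real.smoothTransition t * (t + 1) :=
    (Real.smoothTransition.contDiff (n := 1) |>.continuous_deriv le_rfl).mul (by fun_prop)
  obtain ⟨C, hC⟩ := isCompact_Icc.exists_bound_of_continuousOn (s := Icc (0 : ℝ) 1)
    hcont.continuousOn
  refine ⟨max C 0, le_max_right _ _, fun t => ?_⟩
  by_cases ht : t ∈ Icc (0 : ℝ) 1
  · exact (hC t ht).trans (le_max_left _ _)
  · rw [deriv_smoothTransition_eq_zero (by
      by_contra! h
      exact ht h), zero_mul, abs_zero]
    exact le_max_right _ _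

/-- A continuously differentiable function vanishing at both ends of `[a, b]` is bounded there by
a multiple of the distance to each of the ends. -/
lemma exists_lipschitz_bound {y : ℝ → ℝ} (hy : ContDiff ℝ 1 y) {a b : ℝ} (hab : a < b)
    (ha : y a = 0) (hb : y b = 0) :
    ∃ K : ℝ, 0 ≤ K ∧ ∀ x ∈ Icc a b, |y x| ≤ K * (x - a) ∧ |y x| ≤ K * (b - x) := by
  obtain ⟨K, hK⟩ := isCompact_Icc.exists_bound_of_continuousOn (s := Icc a b)
    (hy.continuous_deriv le_rfl).continuousOn
  have hlip : ∀ u ∈ Icc a b, ∀ v ∈ Icc a b, ‖y v - y u‖ ≤ K * ‖v - u‖ := fun u hu v hv =>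
    (convex_Icc a b).norm_image_sub_le_of_norm_deriv_le
      (fun x _ => hy.differentiable one_ne_zero x) hK hu hv
  refine ⟨K, (norm_nonneg _).trans (hK a (left_mem_Icc.2 hab.le)), fun x hx => ⟨?_, ?_⟩⟩
  · have := hlip a (left_mem_Icc.2 hab.le) x hx
    rwa [ha, sub_zero, Real.norm_eq_abs, Real.norm_eq_abs, abs_of_nonneg (sub_nonneg.2 hx.1)]
      at this
  · have := hlip x hx b (right_mem_Icc.2 hab.le)
    rwa [hb, zero_sub, norm_neg, Real.norm_eq_abs, Real.norm_eq_abs,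
      abs_of_nonneg (sub_nonneg.2 hx.2)] at this

/-- For `α < 0`, a minimal solution is not negative between two of its zeros. -/
lemma MinimalSol.not_neg_between_zeros {α : ℝ} (hα : α < 0) {y : ℝ → ℝ} (hy : MinimalSol α y)
    {a b : ℝ} (hab : a < b) (ha : y a = 0) (hb : y b = 0) (hneg : ∀ x ∈ Ioo a b, y x < 0) :
    False := by
  have cy : Continuous y := hy.1.1.continuous
  obtain ⟨C, hC0, hC⟩ := exists_bound_deriv_smoothTransition
  obtain ⟨K, hK0, hK⟩ := exists_lipschitz_bound (hy.1.1.of_le (by norm_num)) hab ha hb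
  set T := Real.smoothTransition with hT
  have sT : ContDiff ℝ (⊤ : ℕ∞) T := Real.smoothTransition.contDiff
  have cT : Continuous T := sT.continuous
  have cdT : Continuous (deriv T) := sT.continuous_deriv (by simp)
  have dT : ∀ t, HasDerivAt T (deriv T t) t := fun t =>
    (sT.differentiable (by simp) t).hasDerivAt
  have T0 : ∀ t, 0 ≤ T t := Real.smoothTransition.nonneg
  have T1 : ∀ t, T t ≤ 1 := Real.smoothTransition.le_one
  let η : ℕ → ℝ → ℝ := fun n x => T (n * (x - a) - 1) * T (n * (b - x) - 1)
  have hηs : ∀ n, ContDiff ℝ (⊤ : ℕ∞) (η n) := fun n => by fun_prop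
  have hη0 : ∀ n x, 0 ≤ η n x := fun n x => mul_nonneg (T0 _) (T0 _)
  have hη1 : ∀ n x, η n x ≤ 1 := fun n x => mul_le_one₀ (T1 _) (T0 _) (T1 _)
  have hηd : ∀ n x, deriv (η n) x = n * (deriv T (n * (x - a) - 1) * T (n * (b - x) - 1))
      - n * (T (n * (x - a) - 1) * deriv T (n * (b - x) - 1)) := by
    intro n x
    have e1 : HasDerivAt (fun r : ℝ => n * (r - a) - 1) (n : ℝ) x := by
      simpa using (((hasDerivAt_id x).sub_const a).const_mul (n : ℝ)).sub_const 1
    have e2 : HasDerivAt (fun r : ℝ => n * (b - r) - 1) (-n : ℝ) x := by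
      simpa using (((hasDerivAt_id x).const_sub b).const_mul (n : ℝ)).sub_const 1
    have := ((dT _).comp x e1).mul ((dT _).comp x e2)
    refine (this.deriv).trans ?_
    simp only [Function.comp_apply]
    ring
  have hout : ∀ n x, x ∉ Ioo a b → η n x = 0 ∧ deriv (η n) x = 0 := by
    intro n x hx
    have hn : (0 : ℝ) ≤ n := Nat.cast_nonneg n
    rw [mem_Ioo, not_and_or, not_lt, not_lt] at hx
    rw [hηd]
    rcases hx with hx | hx
    · have hlt : n * (x - a) - 1 < 0 := by nlinarith
      have t1 : T (n * (x - a) - 1) = 0 := Real.smoothTransition.zero_of_nonpos hlt.le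
      have t2 : deriv T (n * (x - a) - 1) = 0 := deriv_smoothTransition_eq_zero (Or.inl hlt)
      simp [η, t1, t2]
    · have hlt : n * (b - x) - 1 < 0 := by nlinarith
      have t1 : T (n * (b - x) - 1) = 0 := Real.smoothTransition.zero_of_nonpos hlt.le
      have t2 : deriv T (n * (b - x) - 1) = 0 := deriv_smoothTransition_eq_zero (Or.inl hlt)
      simp [η, t1, t2]
  have hηc : ∀ n, HasCompactSupport (η n) := fun n =>
    HasCompactSupport.intro (isCompact_Icc (a := a) (b := b)) fun x hx =>
      (hout n x fun h => hx (Ioo_subset_Icc_self h)).1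
  have hdy : ∀ n, ∀ x ∈ Icc a b, |deriv (η n) x * y x| ≤ 2 * (K * C) := by
    intro n x hx
    have hn : (0 : ℝ) ≤ n := Nat.cast_nonneg n
    obtain ⟨k1, k2⟩ := hK x hx
    have p1 : |n * (deriv T (n * (x - a) - 1) * T (n * (b - x) - 1)) * y x| ≤ K * C := by
      have c1 := hC (n * (x - a) - 1)
      rw [sub_add_cancel, abs_mul, abs_mul, abs_of_nonneg hn,
        abs_of_nonneg (sub_nonneg.2 hx.1)] at c1
      rw [abs_mul, abs_mul, abs_mul, abs_of_nonneg hn, abs_of_nonneg (T0 _)]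
      calc n * (|deriv T (n * (x - a) - 1)| * T (n * (b - x) - 1)) * |y x|
          ≤ n * (|deriv T (n * (x - a) - 1)| * 1) * (K * (x - a)) := by
            gcongr
            exact T1 _
        _ = K * (|deriv T (n * (x - a) - 1)| * (n * (x - a))) := by ring
        _ ≤ K * C := by gcongr
    have p2 : |n * (T (n * (x - a) - 1) * deriv T (n * (b - x) - 1)) * y x| ≤ K * C := by
      have c1 := hC (n * (b - x) - 1)
      rw [sub_add_cancel, abs_mul, abs_mul, abs_of_nonneg hn,
        abs_of_nonneg (sub_nonneg.2 hx.2)] at c1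
      rw [abs_mul, abs_mul, abs_mul, abs_of_nonneg hn, abs_of_nonneg (T0 _)]
      calc n * (T (n * (x - a) - 1) * |deriv T (n * (b - x) - 1)|) * |y x|
          ≤ n * (1 * |deriv T (n * (b - x) - 1)|) * (K * (b - x)) := by
            gcongr
            exact T1 _
        _ = K * (|deriv T (n * (b - x) - 1)| * (n * (b - x))) := by ring
        _ ≤ K * C := by gcongr
    rw [hηd, sub_mul]
    exact (abs_sub _ _).trans (by linarith)
  let F : ℕ → ℝ → ℝ := fun n s => 2 * (deriv (η n) s * y s) ^ 2 + -2 * α * (η n s ^ 2 * y s)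
      + 8 * y s ^ 4 * (η n s ^ 2 * (1 - η n s) ^ 2)
  set Y := K * (b - a)
  have hY0 : 0 ≤ Y := mul_nonneg hK0 (by linarith)
  have hlim : Tendsto (fun n => ∫ s, F n s) atTop
      (𝓝 (∫ s, (Ioc a b).indicator (fun s => -2 * α * y s) s)) := by
    refine tendsto_integral_of_dominated_convergence
      ((Icc a b).indicator fun _ => 2 * (2 * (K * C)) ^ 2 + -2 * α * Y + 8 * Y ^ 4)
      (fun n => ?_) ?_ (fun n => ?_) ?_
    · have := (hηs n).continuous
      have := (hηs n).continuous_deriv (by simp)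
      exact (by fun_prop : Continuous (F n)).aestronglyMeasurable
    · exact (integrable_indicator_iff measurableSet_Icc).2
        (continuous_const.continuousOn.integrableOn_compact isCompact_Icc)
    · refine Eventually.of_forall fun x => ?_
      by_cases hx : x ∈ Icc a b
      · rw [indicator_of_mem hx]
        have b1 : (deriv (η n) x * y x) ^ 2 ≤ (2 * (K * C)) ^ 2 :=
          sq_le_sq' (abs_le.1 (hdy n x hx)).1 (abs_le.1 (hdy n x hx)).2
        have b2 : |y x| ≤ Y := (hK x hx).1.trans
          (mul_le_mul_of_nonneg_left (by linarith [hx.2]) hK0)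
        have b3 : y x ^ 4 ≤ Y ^ 4 := by
          have := pow_le_pow_left₀ (abs_nonneg _) b2 4
          rwa [Even.pow_abs (by decide)] at this
        have b4 : η n x ^ 2 ≤ 1 := pow_le_one₀ (hη0 n x) (hη1 n x)
        have b5 : (1 - η n x) ^ 2 ≤ 1 :=
          pow_le_one₀ (by linarith [hη1 n x]) (by linarith [hη0 n x])
        have b6 : |η n x ^ 2 * y x| ≤ Y := by
          rw [abs_mul, abs_of_nonneg (sq_nonneg _)]
          calc η n x ^ 2 * |y x| ≤ 1 * Y := by gcongr
            _ = Y := one_mul Y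
        have b7 : y x ^ 4 * (η n x ^ 2 * (1 - η n x) ^ 2) ≤ Y ^ 4 * (1 * 1) := by gcongr
        have b8 : 0 ≤ y x ^ 4 * (η n x ^ 2 * (1 - η n x) ^ 2) := by positivity
        obtain ⟨b9, b10⟩ := abs_le.1 b6
        rw [Real.norm_eq_abs, abs_le]
        simp only [F]
        have b11 : 0 ≤ Y ^ 4 := by positivity
        constructor <;> nlinarith [sq_nonneg (deriv (η n) x * y x)]
      · rw [indicator_of_notMem hx]
        obtain ⟨z1, z2⟩ := hout n x fun h => hx (Ioo_subset_Icc_self h)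
        simp [F, z1, z2]
    · refine Eventually.of_forall fun x => ?_
      refine tendsto_const_nhds.congr' ?_
      by_cases hx : x ∈ Ioo a b
      · rw [indicator_of_mem (Ioo_subset_Ioc_self hx)]
        have l1 : Tendsto (fun n : ℕ => (n : ℝ) * (x - a)) atTop atTop :=
          tendsto_natCast_atTop_atTop.atTop_mul_const (sub_pos.2 hx.1)
        have l2 : Tendsto (fun n : ℕ => (n : ℝ) * (b - x)) atTop atTop :=
          tendsto_natCast_atTop_atTop.atTop_mul_const (sub_pos.2 hx.2)
        filter_upwards [l1.eventually_gt_atTop 2, l2.eventually_gt_atTop 2] with n n1 n2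
        have t1 : T (n * (x - a) - 1) = 1 :=
          Real.smoothTransition.one_of_one_le (by linarith)
        have t2 : T (n * (b - x) - 1) = 1 :=
          Real.smoothTransition.one_of_one_le (by linarith)
        have t3 : deriv T (n * (x - a) - 1) = 0 :=
          deriv_smoothTransition_eq_zero (Or.inr (by linarith))
        have t4 : deriv T (n * (b - x) - 1) = 0 :=
          deriv_smoothTransition_eq_zero (Or.inr (by linarith))
        have t5 : η n x = 1 := by simp [η, t1, t2]
        simp [F, hηd, t3, t4, t5]
      · refine Eventually.of_forall fun n => ?_
        obtain ⟨z1, z2⟩ := hout n x hx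
        by_cases hx' : x ∈ Ioc a b
        · have : x = b := by
            by_contra h
            exact hx ⟨hx'.1, lt_of_le_of_ne hx'.2 h⟩
          rw [indicator_of_mem hx']
          simp [F, this, hb]
        · rw [indicator_of_notMem hx']
          simp [F, z1, z2]
  have hge := ge_of_tendsto' hlim fun n => hy.reflection_increment_nonneg (hηs n) (hηc n)
  rw [integral_indicator measurableSet_Ioc, ← intervalIntegral.integral_of_le hab.le] at hge
  have hpos : 0 < ∫ s in a..b, 2 * α * y s :=
    intervalIntegral.intervalIntegral_pos_of_pos_on
      ((by fun_prop : Continuous fun s => 2 * α * y s).intervalIntegrable a b)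
      (fun x hx => by have := hneg x hx; nlinarith) hab
  have : ∫ s in a..b, -2 * α * y s = -∫ s in a..b, 2 * α * y s := by
    rw [← intervalIntegral.integral_neg]
    congr 1
    ext s
    ring
  linarith

/-- For `α < 0`, a minimal solution bounded near `+∞` is nonnegative after each of its zeros. -/
lemma MinimalSol.nonneg_of_zero_le {α : ℝ} (hα : α < 0) {y : ℝ → ℝ} (hy : MinimalSol α y)
    {m M : ℝ} (hM : ∀ s, m ≤ s → |y s| ≤ M) {p x : ℝ} (hp : y p = 0) (hpx : p ≤ x) :
    0 ≤ y x := by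
  by_contra! hx
  have cy : Continuous y := hy.1.1.continuous
  have hzc : IsClosed {s | y s = 0} := isClosed_eq cy continuous_const
  obtain ⟨a, ⟨ha, ha0⟩, hag⟩ := (isCompact_Icc.inter_right hzc).exists_isGreatest
    (s := Icc p x ∩ {s | y s = 0}) ⟨p, ⟨le_rfl, hpx⟩, hp⟩
  have hax : a < x := lt_of_le_of_ne ha.2 fun h => by
    rw [mem_ofPred_eq, h] at ha0
    exact hx.ne ha0
  have hleft : ∀ s, a < s → s ≤ x → y s < 0 := by
    intro s has hsx
    by_contra! hs
    obtain ⟨r, hr, hr0⟩ := intermediate_value_Icc' hsx cy.continuousOn ⟨hx.le, hs⟩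
    exact absurd (hag ⟨⟨ha.1.trans (has.le.trans hr.1), hr.2⟩, hr0⟩)
      (not_le.2 (has.trans_le hr.1))
  by_cases hz : ∃ z, x ≤ z ∧ y z = 0
  · obtain ⟨z, hxz, hz0⟩ := hz
    obtain ⟨b, ⟨hb, hb0⟩, hbl⟩ := (isCompact_Icc.inter_right hzc).exists_isLeast
      (s := Icc x z ∩ {s | y s = 0}) ⟨z, ⟨hxz, le_rfl⟩, hz0⟩
    refine hy.not_neg_between_zeros hα (hax.trans_le hb.1) ha0 hb0 fun s hs => ?_
    rcases le_total s x with h | h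
    · exact hleft s hs.1 h
    by_contra! hs0
    obtain ⟨r, hr, hr0⟩ := intermediate_value_Icc h cy.continuousOn ⟨hx.le, hs0⟩
    exact absurd (hbl ⟨⟨hr.1, hr.2.trans (hs.2.le.trans hb.2)⟩, hr0⟩)
      (not_le.2 (hr.2.trans_lt hs.2))
  · push Not at hz
    have hneg : ∀ s, x ≤ s → y s < 0 := by
      intro s hs
      by_contra! hs0
      obtain ⟨r, hr, hr0⟩ := intermediate_value_Icc hs cy.continuousOn ⟨hx.le, hs0⟩
      exact hz r hr.1 hr0
    have := eventually_nonpos_of_linear_bound (f := fun s => -y s) (f' := fun s => -deriv y s)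
      (f'' := fun s => -(s * y s + 2 * y s ^ 3 + α)) (X := max 0 m) (c := -α) (C := M)
      (by linarith) (fun s _ => (hy.1.hasDerivAt s).neg)
      (fun s _ => (hy.1.hasDerivAt_deriv s).neg)
      (fun s hs hpos => by
        have h0 : 0 ≤ s := (le_max_left _ _).trans hs
        have h1 : 0 ≤ s * -y s := by positivity
        have h2 : 0 < (-y s) ^ 3 := by positivity
        have h3 : (-y s) ^ 3 = -y s ^ 3 := by ring
        linarith)
      (fun s hs => by
        have h0 : 0 ≤ s := (le_max_left _ _).trans hs
        have := (abs_le.1 (hM s ((le_max_right _ _).trans hs))).1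
        linarith)
    obtain ⟨s, hs, hs'⟩ := (this.and (eventually_ge_atTop x)).exists
    have := hneg s hs'
    linarith

/-- For `α < 0`, a solution has no local minimum at a zero. -/
lemma PainleveSol.not_isLocalMin {α : ℝ} (hα : α < 0) {y : ℝ → ℝ} (hy : PainleveSol α y)
    {p : ℝ} (hp : y p = 0) : ¬ IsLocalMin y p := by
  intro h
  have := second_deriv_nonneg_of_isLocalMin hy.hasDerivAt (hy.hasDerivAt_deriv p) h
  simp [hp] at this
  linarith

/-- A minimal solution of Painlevé II (`α < 0`) which is bounded near `+∞` and vanishes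
somewhere has a unique zero `s̄`, is positive to the right and negative to the left of it,
and satisfies `y(s) ~ |α|/s` at `+∞` and `y(s) ~ -√(|s|/2)` at `-∞`. -/
theorem stmt9 (α : ℝ) (hα : α < 0) (y : ℝ → ℝ) (hy : MinimalSol α y)
    (hbdd : ∃ m M : ℝ, ∀ s : ℝ, m ≤ s → |y s| ≤ M)
    (sbar : ℝ) (hzero : y sbar = 0) :
    (∀ s : ℝ, y s = 0 → s = sbar) ∧
    (∀ s : ℝ, sbar < s → 0 < y s) ∧
    (∀ s : ℝ, s < sbar → y s < 0) ∧
    Filter.Tendsto (fun s => s * y s) Filter.atTop (𝓝 |α|) ∧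
    Filter.Tendsto (fun s => y s + Real.sqrt (|s| / 2)) Filter.atBot (𝓝 0) := by
  obtain ⟨m, M, hM⟩ := hbdd
  have cy : Continuous y := hy.1.1.continuous
  have hlt : ∀ a b, y a = 0 → y b = 0 → ¬ a < b := by
    intro a b ha hb hab
    refine hy.1.not_isLocalMin hα hb ?_
    filter_upwards [lt_mem_nhds hab] with s hs
    rw [hb]
    exact hy.nonneg_of_zero_le hα hM ha hs.le
  have huniq : ∀ s, y s = 0 → s = sbar := fun s hs =>
    le_antisymm (not_lt.1 (hlt _ _ hzero hs)) (not_lt.1 (hlt _ _ hs hzero))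
  have hright : ∀ s, sbar < s → 0 < y s := fun s hs =>
    lt_of_le_of_ne (hy.nonneg_of_zero_le hα hM hzero hs.le) fun h => hs.ne' (huniq s h.symm)
  have hleft : ∀ s, s < sbar → y s < 0 := by
    intro s hs
    by_contra! h
    refine hy.1.not_isLocalMin hα hzero ?_
    filter_upwards [lt_mem_nhds hs] with r hr
    rw [hzero]
    rcases le_total sbar r with hr' | hr'
    · exact hy.nonneg_of_zero_le hα hM hzero hr'
    by_contra! hneg
    obtain ⟨z, hz, hz0⟩ := intermediate_value_Icc' hr.le cy.continuousOn ⟨hneg.le, h⟩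
    rw [huniq z hz0] at hz
    rw [le_antisymm hr' hz.2, hzero] at hneg
    exact lt_irrefl _ hneg
  refine ⟨huniq, hright, hleft, ?_, ?_⟩
  · rw [abs_of_neg hα]
    exact tendsto_mul_of_bounded_of_pos hy.1.hasDerivAt hy.1.hasDerivAt_deriv hM hright
  · obtain ⟨N, hN⟩ := hy.exists_lower_bound
    have d1 : ∀ x, HasDerivAt (fun r => -y (-r)) (deriv y (-x)) x := fun x => by
      refine ((hy.1.hasDerivAt (-x)).scomp x (hasDerivAt_neg x)).neg.congr_deriv ?_
      simp
    have d2 : ∀ x, HasDerivAt (fun r => deriv y (-r))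
        (2 * (-y (-x)) ^ 3 - x * -y (-x) + -α) x := fun x => by
      refine ((hy.1.hasDerivAt_deriv (-x)).scomp x (hasDerivAt_neg x)).congr_deriv ?_
      simp only [smul_eq_mul]
      ring
    have hlim := tendsto_sub_sqrt_half (M := N) (by linarith : 0 ≤ -α) d1 d2
      (by
        filter_upwards [eventually_gt_atTop (-sbar)] with x hx
        have := hleft (-x) (by linarith)
        linarith)
      (Eventually.of_forall fun x => by
        obtain ⟨z, hz, hz'⟩ := hN (-(x + 1))
        refine ⟨-z, ⟨by linarith [hz.2], by linarith [hz.1]⟩, ?_⟩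
        rw [neg_neg, neg_sq]
        linarith)
    have h2 := (hlim.comp tendsto_neg_atBot_atTop).neg
    rw [neg_zero] at h2
    refine h2.congr' ?_
    filter_upwards [eventually_le_atBot 0] with s hs
    simp only [Function.comp_apply, neg_neg, abs_of_nonpos hs]
    ring
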